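/- arXiv:1010.5934 — 14 statements merged into one kernel-verified Lean document; each statement's English description precedes it below -/
import Mathlib

section
/- For all real numbers x and t, the series ∑_{n=0}^∞ (t^n/n!)·T_n(x) converges with sum exp(x·(exp t − 1)); formally, HasSum (fun n => t^n/n! * T_n.eval x) (Real.exp (x * (Real.exp t - 1))). -/
open Polynomial

/-- The Touchard polynomials, defined by `T 0 = 1` and
`T (n+1) = X * (T n + T n')`. -/
noncomputable def Touchard : ℕ → Polynomial ℝ
  | 0 => 1
  | n + 1 => X * (Touchard n + derivative (Touchard n))

theorem hasDerivAt_exp_mul_exp_sub_one (a z : ℂ) :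
    HasDerivAt (fun z => Complex.exp (a * (Complex.exp z - 1)))
      (Complex.exp (a * (Complex.exp z - 1)) * (a * Complex.exp z)) z :=
  (((Complex.hasDerivAt_exp z).sub_const 1).const_mul a).cexp

/-- The iterated derivatives of `exp (a (e ^ z - 1))` are given by the Touchard polynomials
evaluated at `a e ^ z`. -/
theorem iteratedDeriv_exp_mul_exp_sub_one (a : ℂ) (n : ℕ) :
    iteratedDeriv n (fun z => Complex.exp (a * (Complex.exp z - 1))) =
      fun z => aeval (a * Complex.exp z) (Touchard n) *
        Complex.exp (a * (Complex.exp z - 1)) := by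
  induction n with
  | zero => simp [Touchard]
  | succ n ih =>
    rw [iteratedDeriv_succ, ih]
    funext z
    have h := ((Touchard n).hasDerivAt_aeval (a * Complex.exp z)).comp z
      ((Complex.hasDerivAt_exp z).const_mul a)
    refine ((h.mul (hasDerivAt_exp_mul_exp_sub_one a z)).deriv).trans ?_
    simp only [Touchard, map_mul, map_add, aeval_X, Function.comp_apply]
    ring

/-- Generating function of the Touchard polynomials:
`∑ₙ tⁿ/n! · Tₙ(x) = exp (x (eᵗ - 1))`. -/
theorem touchard_generating_function (x t : ℝ) :
    HasSum (fun n : ℕ => t ^ n / (n.factorial : ℝ) * (Touchard n).eval x)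
      (Real.exp (x * (Real.exp t - 1))) := by
  have hd : Differentiable ℂ (fun z => Complex.exp (x * (Complex.exp z - 1))) :=
    fun z => (hasDerivAt_exp_mul_exp_sub_one x z).differentiableAt
  have h := Complex.hasSum_taylorSeries_of_entire hd 0 t
  rw [← Complex.hasSum_ofReal]
  push_cast
  refine h.congr_fun fun n => ?_
  have hT : aeval (x : ℂ) (Touchard n) = (((Touchard n).eval x : ℝ) : ℂ) :=
    aeval_algebraMap_apply_eq_algebraMap_eval x (Touchard n)
  simp only [iteratedDeriv_exp_mul_exp_sub_one, Complex.exp_zero, mul_one, sub_self, mul_zero,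
    sub_zero, smul_eq_mul, hT]
  ring
end

section
/- For every n ∈ ℕ, T_n = ∑_{k=0}^n (1/k!)·(∑_{j=0}^k (−1)^{k−j}·C(k,j)·j^n)·X^k as an identity in ℝ[X], where C(k,j) is the binomial coefficient and 0^0 = 1. -/
open Polynomial Finset

/-- The coefficients of the Touchard polynomials are the Stirling numbers of the second kind. -/
theorem coeff_touchard (n k : ℕ) : (Touchard n).coeff k = (n.stirlingSecond k : ℝ) := by
  induction n generalizing k with
  | zero => cases k <;> simp [Touchard, coeff_one]
  | succ n ih =>
    cases k with
    | zero => simp [Touchard]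
    | succ k =>
      rw [Touchard, coeff_X_mul, coeff_add, coeff_derivative, ih, ih, Nat.stirlingSecond_succ_succ]
      push_cast
      ring

theorem cast_mul_choose_succ (k j : ℕ) :
    (j : ℝ) * ((k + 1).choose j : ℝ) =
      (k + 1) * (((k + 1).choose j : ℝ) - (k.choose j : ℝ)) := by
  rcases le_or_gt j (k + 1) with hj | hj
  · have h := congrArg (Nat.cast : ℕ → ℝ) (Nat.choose_mul_succ_eq k j)
    push_cast [Nat.cast_sub hj] at h
    linarith
  · simp [Nat.choose_eq_zero_of_lt hj, Nat.choose_eq_zero_of_lt (show k < j by omega)]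

/-- The recurrence for the number of surjections, in inclusion-exclusion form. -/
theorem alternating_sum_choose_mul_pow_succ (n k : ℕ) :
    ∑ j ∈ range (k + 2), (-1 : ℝ) ^ (k + 1 - j) * ((k + 1).choose j : ℝ) * (j : ℝ) ^ (n + 1) =
      (k + 1) *
        (∑ j ∈ range (k + 2), (-1 : ℝ) ^ (k + 1 - j) * ((k + 1).choose j : ℝ) * (j : ℝ) ^ n +
          ∑ j ∈ range (k + 1), (-1 : ℝ) ^ (k - j) * (k.choose j : ℝ) * (j : ℝ) ^ n) := by
  have h : ∑ j ∈ range (k + 1), (-1 : ℝ) ^ (k - j) * (k.choose j : ℝ) * (j : ℝ) ^ n =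
      -∑ j ∈ range (k + 2), (-1 : ℝ) ^ (k + 1 - j) * (k.choose j : ℝ) * (j : ℝ) ^ n := by
    rw [sum_range_succ _ (k + 1), Nat.choose_succ_self, Nat.cast_zero, mul_zero, zero_mul,
      add_zero, ← sum_neg_distrib]
    refine sum_congr rfl fun j hj => ?_
    rw [Nat.succ_sub (mem_range_succ_iff.mp hj), pow_succ]
    ring
  rw [h, ← sub_eq_add_neg, ← sum_sub_distrib, mul_sum]
  refine sum_congr rfl fun j _ => ?_
  linear_combination (-1 : ℝ) ^ (k + 1 - j) * (j : ℝ) ^ n * cast_mul_choose_succ k j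

/-- The inclusion-exclusion formula for Stirling numbers of the second kind. -/
theorem alternating_sum_choose_mul_pow (n k : ℕ) :
    ∑ j ∈ range (k + 1), (-1 : ℝ) ^ (k - j) * (k.choose j : ℝ) * (j : ℝ) ^ n =
      (k.factorial : ℝ) * (n.stirlingSecond k : ℝ) := by
  induction n generalizing k with
  | zero =>
    have h := add_pow (1 : ℝ) (-1) k
    simp only [one_pow, one_mul, add_neg_cancel] at h
    simp only [pow_zero, mul_one, ← h]
    cases k <;> simp
  | succ n ih =>
    cases k with
    | zero => simp
    | succ k =>
      rw [alternating_sum_choose_mul_pow_succ, ih, ih, Nat.stirlingSecond_succ_succ,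
        Nat.factorial_succ]
      push_cast
      ring

/-- Explicit expression of the Touchard polynomials:
`Tₙ = ∑_{k=0}^n (1/k!) (∑_{j=0}^k (-1)^{k-j} C(k,j) jⁿ) Xᵏ`. -/
theorem touchard_explicit (n : ℕ) :
    Touchard n =
      ∑ k ∈ range (n + 1),
        C ((1 / (k.factorial : ℝ)) *
            ∑ j ∈ range (k + 1), (-1 : ℝ) ^ (k - j) * (k.choose j : ℝ) * (j : ℝ) ^ n) *
          X ^ k := by
  have hc : ∀ k : ℕ, (1 / (k.factorial : ℝ)) *
      ∑ j ∈ range (k + 1), (-1 : ℝ) ^ (k - j) * (k.choose j : ℝ) * (j : ℝ) ^ n =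
        (n.stirlingSecond k : ℝ) := fun k => by
    rw [alternating_sum_choose_mul_pow, one_div,
      inv_mul_cancel_left₀ (Nat.cast_ne_zero.mpr k.factorial_ne_zero)]
  ext m
  simp only [hc, finsetSum_coeff, coeff_C_mul_X_pow, sum_ite_eq, mem_range, coeff_touchard]
  split_ifs with hm
  · rfl
  · rw [Nat.stirlingSecond_eq_zero_of_lt (by omega), Nat.cast_zero]
end

section
/- For every n ≥ 1, ∑_{k=1}^n ((−1)^{k+1}/k)·(the k-th iterated formal derivative of T_n) = n·T_{n−1} as an identity in ℝ[X]. (The operator log(1+∂_x) acts as the lowering operator for Touchard polynomials.) -/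
open Polynomial Finset

theorem natDegree_touchard_le (n : ℕ) : (Touchard n).natDegree ≤ n := by
  induction n with
  | zero => simp [Touchard]
  | succ n ih =>
    refine natDegree_mul_le.trans ?_
    have h : (Touchard n + derivative (Touchard n)).natDegree ≤ n :=
      natDegree_add_le_of_degree_le ih ((natDegree_derivative_le _).trans (by omega))
    rw [natDegree_X]
    omega

/-- The order-`N` truncation of the operator `log(1 + ∂ₓ)`. -/
noncomputable def logOneAddDerivative (N : ℕ) (p : ℝ[X]) : ℝ[X] :=
  ∑ k ∈ range N, C ((-1 : ℝ) ^ k / ((k : ℝ) + 1)) * derivative^[k + 1] p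

theorem logOneAddDerivative_add (N : ℕ) (p q : ℝ[X]) :
    logOneAddDerivative N (p + q) = logOneAddDerivative N p + logOneAddDerivative N q := by
  simp only [logOneAddDerivative, iterate_map_add, mul_add, sum_add_distrib]

theorem logOneAddDerivative_derivative (N : ℕ) (p : ℝ[X]) :
    logOneAddDerivative N (derivative p) = derivative (logOneAddDerivative N p) := by
  simp only [logOneAddDerivative, derivative_sum, derivative_C_mul,
    ← Function.iterate_succ_apply' derivative, ← Function.iterate_succ_apply derivative]

theorem logOneAddDerivative_X_mul (N : ℕ) (p : ℝ[X]) :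
    logOneAddDerivative N (X * p) =
      X * logOneAddDerivative N p + ∑ k ∈ range N, C ((-1 : ℝ) ^ k) * derivative^[k] p := by
  simp only [logOneAddDerivative, mul_sum, ← sum_add_distrib]
  refine sum_congr rfl fun k _ => ?_
  have h : C ((-1 : ℝ) ^ k / ((k : ℝ) + 1)) * ((k + 1 : ℕ) : ℝ[X]) = C ((-1 : ℝ) ^ k) := by
    rw [← C_eq_natCast, ← C_mul]
    congr 1
    push_cast
    exact div_mul_cancel₀ _ (by positivity)
  rw [mul_comm X p, iterate_derivative_mul_X, nsmul_eq_mul, Nat.add_sub_cancel, ← h]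
  ring

/-- The truncated geometric series of `-∂ₓ` inverts `1 + ∂ₓ` up to its last term. -/
theorem sum_neg_one_pow_mul_iterate_derivative_add_derivative (N : ℕ) (p : ℝ[X]) :
    ∑ k ∈ range N, C ((-1 : ℝ) ^ k) * derivative^[k] (p + derivative p) =
      p - C ((-1 : ℝ) ^ N) * derivative^[N] p := by
  induction N with
  | zero => simp
  | succ N ih =>
    rw [sum_range_succ, ih, iterate_map_add, ← Function.iterate_succ_apply derivative,
      pow_succ, C_mul, C_neg, C_1]
    ring

theorem logOneAddDerivative_touchard {n N : ℕ} (h : n ≤ N) :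
    logOneAddDerivative N (Touchard n) = C (n : ℝ) * Touchard (n - 1) := by
  induction n with
  | zero => simp [logOneAddDerivative, Touchard]
  | succ n ih =>
    rw [Touchard, logOneAddDerivative_X_mul,
      sum_neg_one_pow_mul_iterate_derivative_add_derivative,
      iterate_derivative_eq_zero ((natDegree_touchard_le n).trans_lt h),
      logOneAddDerivative_add, logOneAddDerivative_derivative, ih (by omega)]
    cases n with
    | zero => simp
    | succ m =>
      rw [derivative_C_mul, Nat.add_sub_cancel, Nat.add_sub_cancel, Touchard,
        Nat.cast_add_one (m + 1), C_add, C_1]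
      ring

/-- The operator `log(1 + ∂ₓ)` is the lowering operator for the Touchard
polynomials: `∑_{k=1}^n ((-1)^{k+1}/k) ∂ₓᵏ Tₙ = n T_{n-1}`. -/
theorem touchard_lowering (n : ℕ) (hn : 1 ≤ n) :
    ∑ k ∈ Icc 1 n, C ((-1 : ℝ) ^ (k + 1) / (k : ℝ)) * (derivative^[k] (Touchard n)) =
      C ((n : ℝ)) * Touchard (n - 1) := by
  rw [← logOneAddDerivative_touchard le_rfl, logOneAddDerivative, range_eq_Ico,
    ← Ico_add_one_right_eq_Icc, ← sum_Ico_add' _ 0 n 1]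
  refine sum_congr rfl fun k _ => ?_
  rw [pow_add _ k 2, neg_one_sq, mul_one, Nat.cast_add_one]
end

section
/- For every m ∈ ℕ and all real numbers x and t, HasSum (fun n => t^n/n! * T_{n+m}.eval x) (Real.exp (x*(Real.exp t − 1)) * T_m.eval (Real.exp t * x)); i.e. ∑_{n=0}^∞ (t^n/n!)·T_{n+m}(x) = e^{x(e^t−1)}·T_m(e^t·x). -/
open Polynomial

/-- The exponential generating function of the shifted Touchard polynomials, as an entire
function. -/
noncomputable def touchardShiftedEGF (x : ℂ) (m : ℕ) (z : ℂ) : ℂ :=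
  Complex.exp (x * (Complex.exp z - 1)) * aeval (Complex.exp z * x) (Touchard m)

theorem hasDerivAt_touchardShiftedEGF (x : ℂ) (m : ℕ) (z : ℂ) :
    HasDerivAt (touchardShiftedEGF x m) (touchardShiftedEGF x (m + 1) z) z := by
  have hexp := Complex.hasDerivAt_exp z
  have hpoly := ((Touchard m).hasDerivAt_aeval (Complex.exp z * x)).comp z (hexp.mul_const x)
  refine ((((hexp.sub_const 1).const_mul x).cexp).mul hpoly).congr_deriv ?_
  simp only [touchardShiftedEGF, Touchard, map_mul, map_add, aeval_X, Function.comp_apply]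
  ring

theorem iteratedDeriv_touchardShiftedEGF (x : ℂ) (m n : ℕ) :
    iteratedDeriv n (touchardShiftedEGF x m) = touchardShiftedEGF x (n + m) := by
  induction n with
  | zero => simp
  | succ n ih =>
    rw [iteratedDeriv_succ, ih, Nat.add_right_comm]
    exact funext fun z => (hasDerivAt_touchardShiftedEGF x (n + m) z).deriv

theorem touchardShiftedEGF_ofReal (x : ℝ) (m : ℕ) (t : ℝ) :
    touchardShiftedEGF x m t =
      (Real.exp (x * (Real.exp t - 1)) * (Touchard m).eval (Real.exp t * x) : ℝ) := by
  have h := aeval_algebraMap_apply ℂ (Real.exp t * x) (Touchard m)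
  simp only [Complex.coe_algebraMap, coe_aeval_eq_eval] at h
  rw [touchardShiftedEGF, Complex.ofReal_mul, ← h]
  push_cast
  rfl

/-- Generalized generating function:
`∑ₙ tⁿ/n! · T_{n+m}(x) = e^{x(eᵗ-1)} T_m(eᵗ x)`. -/
theorem touchard_shifted_generating_function (m : ℕ) (x t : ℝ) :
    HasSum (fun n : ℕ => t ^ n / (n.factorial : ℝ) * (Touchard (n + m)).eval x)
      (Real.exp (x * (Real.exp t - 1)) * (Touchard m).eval (Real.exp t * x)) := by
  have h := Complex.hasSum_taylorSeries_of_entire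
    (fun z => (hasDerivAt_touchardShiftedEGF (x : ℂ) m z).differentiableAt) 0 (t : ℂ)
  rw [touchardShiftedEGF_ofReal] at h
  refine Complex.hasSum_ofReal.1 (h.congr_fun fun n => ?_)
  have h0 := touchardShiftedEGF_ofReal x (n + m) 0
  simp only [Complex.ofReal_zero, Real.exp_zero, sub_self, mul_zero, one_mul] at h0
  rw [iteratedDeriv_touchardShiftedEGF, h0]
  push_cast [smul_eq_mul]
  ring
end

section
/- Define the linear operators M, D : ℝ[X] → ℝ[X] by M p = X·p + X·p' and D p = X·p', where p' is the formal derivative. Then for every m ∈ ℕ and every p ∈ ℝ[X], M^[m] p = ∑_{r=0}^m C(m,r)·T_{m−r}·(D^[r] p), where M^[m] and D^[r] denote functional iterates and C(m,r) is the binomial coefficient. -/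
open Polynomial Finset

/-- The multiplicative operator `M = x(1 + ∂ₓ)`. -/
noncomputable def Mop (p : Polynomial ℝ) : Polynomial ℝ :=
  X * p + X * derivative p

/-- The operator `D = x ∂ₓ`. -/
noncomputable def Dop (p : Polynomial ℝ) : Polynomial ℝ :=
  X * derivative p

theorem Mop_sum {ι : Type*} (s : Finset ι) (f : ι → ℝ[X]) :
    Mop (∑ i ∈ s, f i) = ∑ i ∈ s, Mop (f i) := by
  simp only [Mop, derivative_sum, mul_sum, sum_add_distrib]

theorem Mop_natCast_mul (n : ℕ) (p : ℝ[X]) : Mop (n * p) = n * Mop p := by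
  simp only [Mop, derivative_natCast_mul]
  ring

theorem Mop_mul (p q : ℝ[X]) : Mop (p * q) = Mop p * q + p * Dop q := by
  simp only [Mop, Dop, derivative_mul]
  ring

theorem Mop_Touchard (n : ℕ) : Mop (Touchard n) = Touchard (n + 1) := by
  rw [Mop, Touchard, mul_add]

theorem iterate_Mop_eq_sum_antidiagonal (m : ℕ) (p : ℝ[X]) :
    Mop^[m] p =
      ∑ ij ∈ antidiagonal m, (m.choose ij.1 : ℝ[X]) * (Touchard ij.2 * Dop^[ij.1] p) := by
  induction m with
  | zero => simp [Touchard]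
  | succ m ih =>
    rw [Function.iterate_succ_apply', ih, Mop_sum,
      sum_antidiagonal_choose_succ_mul fun i j => Touchard j * Dop^[i] p, ← sum_add_distrib]
    refine sum_congr rfl fun ij hij => ?_
    rw [Mop_natCast_mul, Mop_mul, Mop_Touchard, Function.iterate_succ_apply', mul_add,
      Nat.choose_symm_of_eq_add (mem_antidiagonal.mp hij).symm]

/-- Operational identity `(x + x∂ₓ)^m = ∑_{r=0}^m C(m,r) T_{m-r}(x) (x∂ₓ)^r`. -/
theorem touchard_operational_identity (m : ℕ) (p : Polynomial ℝ) :
    Mop^[m] p = ∑ r ∈ range (m + 1), (m.choose r : ℝ[X]) * Touchard (m - r) * Dop^[r] p := by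
  rw [iterate_Mop_eq_sum_antidiagonal, Nat.sum_antidiagonal_eq_sum_range_succ_mk]
  simp only [mul_assoc]
end

section
/- Let g : ℕ → ℝ → ℝ be defined by g 0 = Real.exp and g (n+1) x = x^2 * deriv (g n) x. Then for every n ∈ ℕ and every x ∈ ℝ, g n x = (T²_n.eval x) * Real.exp x. (Rodrigues-type formula T²_n(x) = e^{-x}(x² d/dx)^n e^x for the second-order Touchard polynomials.) -/
open Polynomial

/-- The second-order Touchard polynomials, defined by `T² 0 = 1` and
`T² (n+1) = X² * (T² n + (T² n)')`. -/
noncomputable def Touchard2 : ℕ → Polynomial ℝ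
  | 0 => 1
  | n + 1 => X ^ 2 * (Touchard2 n + derivative (Touchard2 n))

/-- Rodrigues-type formula `T²ₙ(x) = e^{-x} (x² d/dx)^n e^x` for the
second-order Touchard polynomials. -/
theorem touchard2_rodrigues (g : ℕ → ℝ → ℝ)
    (h0 : g 0 = Real.exp)
    (hrec : ∀ n x, g (n + 1) x = x ^ 2 * deriv (g n) x) :
    ∀ n x, g n x = (Touchard2 n).eval x * Real.exp x := by
  intro n
  induction n with
  | zero => simp [h0, Touchard2]
  | succ n ih =>
    intro x
    have hderiv := ((Touchard2 n).hasDerivAt x).mul (Real.hasDerivAt_exp x)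
    have hg : g n = (fun y => (Touchard2 n).eval y) * Real.exp := funext ih
    rw [hrec, hg, hderiv.deriv]
    simp only [Touchard2, eval_mul, eval_pow, eval_X, eval_add]
    ring
end

section
/- For all real numbers x and t with |t·x| < 1, HasSum (fun n => t^n/n! * T²_n.eval x) (Real.exp (t*x^2/(1 − t*x))); i.e. ∑_{n=0}^∞ (t^n/n!)·T²_n(x) = e^{t x²/(1−t x)}. -/
open Polynomial

lemma hasDerivAt_div_one_sub_mul {x z : ℂ} (hz : 1 - z * x ≠ 0) :
    HasDerivAt (fun w : ℂ => x / (1 - w * x)) ((x / (1 - z * x)) ^ 2) z := by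
  have hd : HasDerivAt (fun w : ℂ => 1 - w * x) (-x) z := by
    simpa using ((hasDerivAt_id z).mul_const x).const_sub 1
  refine ((hasDerivAt_const z x).fun_div hd hz).congr_deriv ?_
  field_simp
  ring

lemma hasDerivAt_aeval_mul_exp {x z : ℂ} (hz : 1 - z * x ≠ 0) (p : ℝ[X]) :
    HasDerivAt
      (fun w : ℂ => aeval (x / (1 - w * x)) p * Complex.exp (x / (1 - w * x) - x))
      (aeval (x / (1 - z * x)) (X ^ 2 * (p + derivative p)) *
        Complex.exp (x / (1 - z * x) - x)) z := by
  have hu := hasDerivAt_div_one_sub_mul hz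
  have hp := (p.hasDerivAt_aeval (x / (1 - z * x))).comp z hu
  refine (hp.mul (hu.sub_const x).cexp).congr_deriv ?_
  simp only [Function.comp_apply, map_mul, map_add, map_pow, aeval_X]
  ring

lemma iteratedDeriv_exp_touchard2 (x : ℂ) (n : ℕ) {z : ℂ} (hz : 1 - z * x ≠ 0) :
    iteratedDeriv n (fun w : ℂ => Complex.exp (x / (1 - w * x) - x)) z =
      aeval (x / (1 - z * x)) (Touchard2 n) * Complex.exp (x / (1 - z * x) - x) := by
  induction n generalizing z with
  | zero => simp [Touchard2]
  | succ n ih =>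
    have hev : ∀ᶠ w in nhds z, 1 - w * x ≠ 0 :=
      (by fun_prop : ContinuousAt (fun w : ℂ => 1 - w * x) z).eventually_ne hz
    rw [iteratedDeriv_succ, Filter.EventuallyEq.deriv_eq (hev.mono fun w hw => ih hw),
      (hasDerivAt_aeval_mul_exp hz _).deriv, Touchard2]

/-- Generating function of the second-order Touchard polynomials:
`∑ₙ tⁿ/n! · T²ₙ(x) = e^{t x² / (1 - t x)}` for `|t x| < 1`. -/
theorem touchard2_generating_function (x t : ℝ) (h : |t * x| < 1) :
    HasSum (fun n : ℕ => t ^ n / (n.factorial : ℝ) * (Touchard2 n).eval x)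
      (Real.exp (t * x ^ 2 / (1 - t * x))) := by
  obtain ⟨r, htr, hr⟩ : ∃ r, |t| < r ∧ r * |x| ≤ 1 := by
    rcases eq_or_ne x 0 with rfl | hx
    · exact ⟨|t| + 1, by linarith, by simp⟩
    · have hx' : 0 < |x| := abs_pos.mpr hx
      exact ⟨1 / |x|, by rwa [lt_div_iff₀ hx', ← abs_mul], by field_simp; rfl⟩
  have hne : ∀ z ∈ Metric.ball (0 : ℂ) r, 1 - z * (x : ℂ) ≠ 0 := by
    intro z hz hzero
    rw [mem_ball_zero_iff] at hz
    have hnorm : ‖z‖ * |x| = 1 := by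
      simpa using congrArg norm (sub_eq_zero.mp hzero).symm
    nlinarith [abs_nonneg x, norm_nonneg z]
  have hdiff : DifferentiableOn ℂ
      (fun w : ℂ => Complex.exp (x / (1 - w * x) - x)) (Metric.ball 0 r) := fun z hz =>
    ((hasDerivAt_div_one_sub_mul (hne z hz)).sub_const
      _).cexp.differentiableAt.differentiableWithinAt
  have htmem : (t : ℂ) ∈ Metric.ball (0 : ℂ) r := by simpa using htr
  have hsum := Complex.hasSum_taylorSeries_on_ball hdiff htmem
  have hterm (n : ℕ) :
      ((n.factorial : ℂ)⁻¹ • ((t : ℂ) - 0) ^ n •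
        iteratedDeriv n (fun w : ℂ => Complex.exp (x / (1 - w * x) - x)) 0) =
      ((t ^ n / (n.factorial : ℝ) * (Touchard2 n).eval x : ℝ) : ℂ) := by
    have heval : aeval (x : ℂ) (Touchard2 n) = (((Touchard2 n).eval x : ℝ) : ℂ) := by
      simpa using aeval_algebraMap_apply ℂ x (Touchard2 n)
    rw [iteratedDeriv_exp_touchard2 _ _ (by simp)]
    simp only [zero_mul, sub_zero, div_one, sub_self, Complex.exp_zero, mul_one, heval,
      smul_eq_mul]
    push_cast
    ring
  have hvalue : Complex.exp (x / (1 - t * x) - x) =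
      (Real.exp (t * x ^ 2 / (1 - t * x)) : ℂ) := by
    have ht := hne t htmem
    push_cast
    congr 1
    rw [div_sub' ht]
    ring
  simp only [hterm, hvalue] at hsum
  exact Complex.hasSum_ofReal.mp hsum
end

section
/- For every m ∈ ℕ and all real numbers x and t with |t·x| < 1, HasSum (fun n => t^n/n! * T²_{n+m}.eval x) (Real.exp (t*x^2/(1 − t*x)) * T²_m.eval (x/(1 − t*x))); i.e. ∑_{n=0}^∞ (t^n/n!)·T²_{n+m}(x) = e^{t x²/(1−t x)}·T²_m(x/(1−t x)). -/
open Polynomial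

/-- The closed form of the generating function at complex argument `z`, written through
`u = x / (1 - x z)`, for which `z x² / (1 - z x) = u - x`. -/
noncomputable def touchard2GenFun (m : ℕ) (x : ℂ) (z : ℂ) : ℂ :=
  Complex.exp (x / (1 - z * x) - x) * aeval (x / (1 - z * x)) (Touchard2 m)

theorem hasDerivAt_touchard2GenFun (m : ℕ) {x z : ℂ} (h : 1 - z * x ≠ 0) :
    HasDerivAt (touchard2GenFun m x) (touchard2GenFun (m + 1) x z) z := by
  have hu : HasDerivAt (fun z : ℂ => x / (1 - z * x)) ((x / (1 - z * x)) ^ 2) z := by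
    refine ((hasDerivAt_const z x).fun_div
      (((hasDerivAt_id' z).mul_const x).const_sub 1) h).congr_deriv ?_
    field_simp
    ring
  have hp := (Polynomial.hasDerivAt_aeval (Touchard2 m) (x / (1 - z * x))).comp z hu
  refine ((hu.sub_const x).cexp.mul hp).congr_deriv ?_
  simp only [touchard2GenFun, Touchard2, map_mul, map_add, map_pow, aeval_X, Function.comp]
  ring

theorem iteratedDeriv_touchard2GenFun (m n : ℕ) {x z : ℂ} (h : 1 - z * x ≠ 0) :
    iteratedDeriv n (touchard2GenFun m x) z = touchard2GenFun (n + m) x z := by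
  induction n generalizing z with
  | zero => simp
  | succ n ih =>
    have hev : ∀ᶠ w in nhds z, 1 - w * x ≠ 0 :=
      (by fun_prop : Continuous fun w : ℂ => 1 - w * x).continuousAt.eventually_ne h
    rw [iteratedDeriv_succ, Filter.EventuallyEq.deriv_eq (hev.mono fun w hw => ih hw),
      (hasDerivAt_touchard2GenFun (n + m) h).deriv, Nat.add_right_comm]

theorem hasSum_touchard2GenFun (m : ℕ) {x z : ℂ} (h : ‖z * x‖ < 1) :
    HasSum (fun n : ℕ => z ^ n / (n.factorial : ℂ) * aeval x (Touchard2 (n + m)))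
      (touchard2GenFun m x z) := by
  obtain ⟨r, hr, hzr⟩ : ∃ r : ℝ, r * ‖x‖ ≤ 1 ∧ ‖z‖ < r := by
    rcases eq_or_ne x 0 with rfl | hx
    · exact ⟨‖z‖ + 1, by simp, by simp⟩
    · have hx' : 0 < ‖x‖ := norm_pos_iff.mpr hx
      exact ⟨‖x‖⁻¹, (inv_mul_cancel₀ hx'.ne').le, by
        rwa [norm_mul, ← lt_div_iff₀ hx', one_div] at h⟩
  have hne : ∀ w ∈ Metric.ball (0 : ℂ) r, 1 - w * x ≠ 0 := by
    intro w hw h0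
    rw [mem_ball_zero_iff] at hw
    have h1 : ‖w‖ * ‖x‖ = 1 := by rw [← norm_mul, ← sub_eq_zero.mp h0, norm_one]
    rcases (norm_nonneg x).eq_or_lt with hx | hx
    · simp [← hx] at h1
    · nlinarith
  have hd : DifferentiableOn ℂ (touchard2GenFun m x) (Metric.ball 0 r) := fun w hw =>
    (hasDerivAt_touchard2GenFun m (hne w hw)).differentiableAt.differentiableWithinAt
  refine (Complex.hasSum_taylorSeries_on_ball hd (mem_ball_zero_iff.mpr hzr)).congr_fun fun n => ?_
  rw [iteratedDeriv_touchard2GenFun m n (by simp)]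
  simp only [touchard2GenFun, zero_mul, sub_zero, div_one, sub_self, Complex.exp_zero, one_mul,
    smul_eq_mul]
  ring

/-- Generalized generating function of the second-order Touchard polynomials:
`∑ₙ tⁿ/n! · T²_{n+m}(x) = e^{t x² / (1 - t x)} T²_m(x / (1 - t x))` for `|t x| < 1`. -/
theorem touchard2_shifted_generating_function (m : ℕ) (x t : ℝ) (h : |t * x| < 1) :
    HasSum (fun n : ℕ => t ^ n / (n.factorial : ℝ) * (Touchard2 (n + m)).eval x)
      (Real.exp (t * x ^ 2 / (1 - t * x)) * (Touchard2 m).eval (x / (1 - t * x))) := by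
  have hne : 1 - t * x ≠ 0 := fun h0 => by
    rw [← sub_eq_zero.mp h0, abs_one] at h
    exact h.false
  have hexp : t * x ^ 2 / (1 - t * x) = x / (1 - t * x) - x := by
    field_simp
    ring
  have hs := hasSum_touchard2GenFun m (x := x) (z := t)
    (by rwa [← Complex.ofReal_mul, Complex.norm_real, Real.norm_eq_abs])
  have h_ofReal (p : ℝ[X]) (y : ℝ) : aeval (y : ℂ) p = ((p.eval y : ℝ) : ℂ) :=
    aeval_algebraMap_apply_eq_algebraMap_eval y p
  rw [← Complex.hasSum_ofReal, hexp]
  convert hs using 1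
  · ext n
    simp [h_ofReal]
  · rw [touchard2GenFun]
    norm_cast
    rw [h_ofReal]
    norm_cast
end

section
/- Define the linear operators N, E : ℝ[X] → ℝ[X] by N p = X²·p + X²·p' and E p = X²·p', where p' is the formal derivative. Then for every m ∈ ℕ and every p ∈ ℝ[X], N^[m] p = ∑_{r=0}^m C(m,r)·T²_{m−r}·(E^[r] p), where N^[m] and E^[r] denote functional iterates and C(m,r) is the binomial coefficient. -/
open Polynomial Finset

/-- The multiplicative operator `N = x²(1 + ∂ₓ)`. -/
noncomputable def Nop (p : Polynomial ℝ) : Polynomial ℝ :=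
  X ^ 2 * p + X ^ 2 * derivative p

/-- The operator `E = x² ∂ₓ`. -/
noncomputable def Eop (p : Polynomial ℝ) : Polynomial ℝ :=
  X ^ 2 * derivative p

/-- Leibniz-type rule: multiplying by a Touchard polynomial intertwines `Nop` and `Eop`. -/
theorem Nop_Touchard2_mul (k : ℕ) (q : ℝ[X]) :
    Nop (Touchard2 k * q) = Touchard2 (k + 1) * q + Touchard2 k * Eop q := by
  simp only [Nop, Eop, Touchard2, derivative_mul]
  ring

theorem Nop_natCast_mul (c : ℕ) (q : ℝ[X]) : Nop ((c : ℝ[X]) * q) = (c : ℝ[X]) * Nop q := by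
  simp only [Nop, derivative_natCast_mul]
  ring

theorem Nop_sum {ι : Type*} (s : Finset ι) (f : ι → ℝ[X]) :
    Nop (∑ i ∈ s, f i) = ∑ i ∈ s, Nop (f i) := by
  simp only [Nop, derivative_sum, Finset.mul_sum, Finset.sum_add_distrib]

/-- Operational identity `(x² + x²∂ₓ)^m = ∑_{r=0}^m C(m,r) T²_{m-r}(x) (x²∂ₓ)^r`. -/
theorem touchard2_operational_identity (m : ℕ) (p : Polynomial ℝ) :
    Nop^[m] p = ∑ r ∈ range (m + 1), (m.choose r : ℝ[X]) * Touchard2 (m - r) * Eop^[r] p := by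
  induction m with
  | zero => simp [Touchard2]
  | succ m ih =>
    have hpascal := Finset.sum_choose_succ_mul (fun r k => Touchard2 k * Eop^[r] p) m
    simp only [← mul_assoc] at hpascal
    rw [Function.iterate_succ_apply', ih, Nop_sum, hpascal, ← Finset.sum_add_distrib]
    refine Finset.sum_congr rfl fun r hr => ?_
    rw [mul_assoc, Nop_natCast_mul, Nop_Touchard2_mul, Function.iterate_succ_apply',
      Nat.succ_sub (Nat.lt_succ_iff.mp (Finset.mem_range.mp hr))]
    ring
end

section
/- For every n ≥ 1, T²_n = ∑_{k=1}^n S₂²(k,n)·X^{n+k} as an identity in ℝ[X], where S₂²(k,n) = (1/k!)·∑_{j=1}^k (−1)^{k−j}·C(k,j)·(n+j−1)!/(j−1)!. -/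
open Polynomial Finset

/-- The generalized Stirling numbers
`S₂²(k, n) = (1/k!) ∑_{j=1}^k (-1)^{k-j} C(k,j) (n+j-1)!/(j-1)!`. -/
noncomputable def stirling2nd (k n : ℕ) : ℝ :=
  (1 / (k.factorial : ℝ)) *
    ∑ j ∈ Icc 1 k,
      (-1 : ℝ) ^ (k - j) * (k.choose j : ℝ) * (((n + j - 1).factorial : ℝ) / ((j - 1).factorial : ℝ))

theorem stirling2nd_zero_left (n : ℕ) : stirling2nd 0 n = 0 := by
  simp [stirling2nd]

/-- The triangular recurrence of the generalized Stirling numbers. -/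
theorem stirling2nd_succ_succ (k n : ℕ) :
    stirling2nd (k + 1) (n + 1) =
      stirling2nd k n + ((n : ℝ) + k + 1) * stirling2nd (k + 1) n := by
  have hk : ∑ j ∈ Icc 1 k, (-1 : ℝ) ^ (k - j) * (k.choose j : ℝ) *
        (((n + j - 1).factorial : ℝ) / ((j - 1).factorial : ℝ)) =
      ∑ j ∈ Icc 1 (k + 1), -(-1 : ℝ) ^ (k + 1 - j) * (k.choose j : ℝ) *
        (((n + j - 1).factorial : ℝ) / ((j - 1).factorial : ℝ)) := by
    rw [sum_Icc_succ_top (by omega)]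
    simp only [Nat.choose_succ_self, Nat.cast_zero, mul_zero, zero_mul, add_zero]
    refine sum_congr rfl fun j hj => ?_
    rw [Nat.sub_add_comm (mem_Icc.1 hj).2, pow_succ]
    ring
  have hfac : ((k + 1).factorial : ℝ) = (k + 1) * k.factorial := by
    rw [Nat.factorial_succ]
    push_cast
    ring
  have hk0 : (k.factorial : ℝ) ≠ 0 := by positivity
  have hk1 : (k : ℝ) + 1 ≠ 0 := by positivity
  simp only [stirling2nd]
  rw [hk, hfac]
  field_simp
  rw [mul_sum, mul_sum, ← sum_add_distrib]
  refine sum_congr rfl fun j hj => ?_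
  obtain ⟨hj1, hjk⟩ := mem_Icc.1 hj
  obtain ⟨i, rfl⟩ := Nat.exists_eq_add_of_le' hj1
  have hchoose : ((k : ℝ) + 1) * k.choose (i + 1) = (k + 1).choose (i + 1) * ((k : ℝ) - i) := by
    have h := Nat.choose_mul_succ_eq k (i + 1)
    have hsub : ((k + 1 - (i + 1) : ℕ) : ℝ) = (k : ℝ) - i := by
      rw [Nat.cast_sub hjk]
      push_cast
      ring
    rw [← hsub, mul_comm]
    exact_mod_cast h
  have hf : ((n + 1 + (i + 1) - 1).factorial : ℝ) =
      ((n : ℝ) + i + 1) * (n + (i + 1) - 1).factorial := by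
    rw [show n + 1 + (i + 1) - 1 = n + i + 1 by omega, show n + (i + 1) - 1 = n + i by omega,
      Nat.factorial_succ]
    push_cast
    ring
  rw [hf]
  linear_combination (-1 : ℝ) ^ (k + 1 - (i + 1)) *
    (((n + (i + 1) - 1).factorial : ℝ) / ((i + 1 - 1).factorial : ℝ)) * hchoose

theorem stirling2nd_succ_zero (k : ℕ) :
    stirling2nd (k + 1) 0 = (-1) ^ k / ((k + 1).factorial : ℝ) := by
  have h := add_pow (1 : ℝ) (-1) (k + 1)
  rw [sum_range_succ', add_neg_cancel, zero_pow (by omega)] at h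
  have hs : ∑ j ∈ Icc 1 (k + 1), (-1 : ℝ) ^ (k + 1 - j) * ((k + 1).choose j : ℝ) *
        (((0 + j - 1).factorial : ℝ) / ((j - 1).factorial : ℝ)) =
      ∑ j ∈ range (k + 1), 1 ^ (j + 1) * (-1 : ℝ) ^ (k + 1 - (j + 1)) *
        ((k + 1).choose (j + 1) : ℝ) := by
    rw [range_eq_Ico, sum_Ico_add' (fun j => 1 ^ j * (-1 : ℝ) ^ (k + 1 - j) *
      ((k + 1).choose j : ℝ)) 0 (k + 1) 1]
    refine sum_congr (by ext; simp) fun j _ => ?_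
    rw [zero_add, div_self (by positivity)]
    ring
  rw [stirling2nd, hs, one_div_mul_eq_div]
  congr 1
  simp only [pow_zero, Nat.sub_zero, Nat.choose_zero_right, Nat.cast_one, pow_succ] at h ⊢
  linarith

theorem stirling2nd_eq_zero_of_lt {k n : ℕ} (hn : 1 ≤ n) (h : n < k) : stirling2nd k n = 0 := by
  induction n, hn using Nat.le_induction generalizing k with
  | base =>
    obtain ⟨k, rfl⟩ := Nat.exists_eq_add_of_le' h
    have hk : ((k + 1 + 1).factorial : ℝ) = (k + 1 + 1) * (k + 1).factorial := by
      rw [Nat.factorial_succ]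
      push_cast
      ring
    rw [show k + (1 + 1) = k + 1 + 1 by omega,
      show stirling2nd (k + 1 + 1) 1 = _ from stirling2nd_succ_succ (k + 1) 0,
      stirling2nd_succ_zero, stirling2nd_succ_zero, hk]
    have : (k : ℝ) + 1 + 1 ≠ 0 := by positivity
    push_cast
    field_simp
    ring
  | succ n hn ih =>
    obtain ⟨k, rfl⟩ := Nat.exists_eq_add_of_le' (show 1 ≤ k by omega)
    rw [stirling2nd_succ_succ, ih (by omega), ih (by omega)]
    ring

/-- Explicit expression of the second-order Touchard polynomials through the
generalized Stirling numbers: `T²ₙ = ∑_{k=1}^n S₂²(k,n) X^{n+k}` for `n ≥ 1`. -/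
theorem touchard2_explicit (n : ℕ) (hn : 1 ≤ n) :
    Touchard2 n = ∑ k ∈ Icc 1 n, C (stirling2nd k n) * X ^ (n + k) := by
  induction n, hn using Nat.le_induction with
  | base => simp [Touchard2, stirling2nd, pow_two]
  | succ n hn ih =>
    have hshift : ∑ k ∈ Icc 1 (n + 1), C (stirling2nd (k - 1) n) * X ^ (n + 1 + k) =
        ∑ k ∈ Icc 1 n, C (stirling2nd k n) * X ^ (n + 2 + k) := by
      have h := sum_Ico_add'
        (fun k => C (stirling2nd (k - 1) n) * (X : ℝ[X]) ^ (n + 1 + k)) 0 (n + 1) 1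
      rw [sum_eq_sum_Ico_succ_bot (Nat.succ_pos n)] at h
      simp only [zero_add, Nat.add_sub_cancel, Nat.sub_self, stirling2nd_zero_left, C_0, zero_mul] at h
      rw [← Ico_add_one_right_eq_Icc, ← Ico_add_one_right_eq_Icc, ← h]
      refine sum_congr rfl fun k _ => ?_
      ring
    have htop : ∑ k ∈ Icc 1 (n + 1), C (((n : ℝ) + k) * stirling2nd k n) * X ^ (n + 1 + k) =
        ∑ k ∈ Icc 1 n, C (((n : ℝ) + k) * stirling2nd k n) * X ^ (n + 1 + k) := by
      rw [sum_Icc_succ_top (by omega), stirling2nd_eq_zero_of_lt hn (Nat.lt_succ_self n)]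
      simp
    have hrec : ∀ k ∈ Icc 1 (n + 1), C (stirling2nd k (n + 1)) * X ^ (n + 1 + k) =
        C (stirling2nd (k - 1) n) * X ^ (n + 1 + k) +
          C (((n : ℝ) + k) * stirling2nd k n) * X ^ (n + 1 + k) := by
      intro k hk
      obtain ⟨i, rfl⟩ := Nat.exists_eq_add_of_le' (mem_Icc.1 hk).1
      rw [stirling2nd_succ_succ, ← add_mul, ← C_add, Nat.add_sub_cancel]
      push_cast
      ring_nf
    rw [sum_congr rfl hrec, sum_add_distrib, hshift, htop, Touchard2, ih, derivative_sum, mul_add,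
      mul_sum, mul_sum]
    congr 1
    · refine sum_congr rfl fun k _ => ?_
      ring
    · refine sum_congr rfl fun k hk => ?_
      obtain ⟨i, rfl⟩ := Nat.exists_eq_add_of_le' (mem_Icc.1 hk).1
      rw [derivative_C_mul_X_pow, show n + (i + 1) - 1 = n + i by omega, mul_comm (stirling2nd _ _)]
      push_cast
      ring
end

section
/- Define the linear operator E : ℝ[X] → ℝ[X] by E p = X²·p', where p' is the formal derivative. Then for every n ≥ 1 and every p ∈ ℝ[X], E^[n] p = ∑_{k=1}^n S₂²(k,n)·X^{n+k}·(the k-th iterated formal derivative of p), where S₂²(k,n) = (1/k!)·∑_{j=1}^k (−1)^{k−j}·C(k,j)·(n+j−1)!/(j−1)!. (Operational identity (x²∂_x)^n = xⁿ ∑_k S₂²(k,n) x^k ∂_x^k.) -/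
open Polynomial Finset

theorem ascPochhammer_eval_natCast_eq_factorial_div (n : ℕ) {j : ℕ} (hj : 1 ≤ j) :
    (ascPochhammer ℝ n).eval (j : ℝ) = ((n + j - 1).factorial : ℝ) / ((j - 1).factorial : ℝ) := by
  rw [← Nat.cast_ascFactorial, eq_div_iff (by positivity), mul_comm, add_comm n j]
  exact_mod_cast Nat.factorial_mul_ascFactorial' j n hj

/-- The generalized Stirling numbers are the normalized forward differences at `0` of the
rising factorial. -/
theorem factorial_mul_stirling2nd {n : ℕ} (hn : 1 ≤ n) (k : ℕ) :
    (k.factorial : ℝ) * stirling2nd k n = (fwdDiff 1)^[k] (ascPochhammer ℝ n).eval 0 := by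
  rw [stirling2nd, ← mul_assoc, mul_one_div_cancel (by positivity), one_mul,
    fwdDiff_iter_eq_sum_shift, Finset.sum_range_eq_add_Ico _ k.succ_pos]
  simp only [zero_smul, add_zero, ascPochhammer_ne_zero_eval_zero ℝ (by lia : n ≠ 0), smul_zero,
    zero_add]
  refine Finset.sum_congr (by ext; simp) fun j hj => ?_
  rw [← ascPochhammer_eval_natCast_eq_factorial_div n (Finset.mem_Icc.mp hj).1]
  simp

/-- Newton expansion of the rising factorial in falling factorials. -/
theorem sum_stirling2nd_mul_descFactorial {n : ℕ} (hn : 1 ≤ n) (m : ℕ) :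
    ∑ k ∈ Icc 1 n, stirling2nd k n * (m.descFactorial k : ℝ) =
      (ascPochhammer ℝ n).eval (m : ℝ) := by
  have newton := shift_eq_sum_fwdDiff_iter (1 : ℝ) (ascPochhammer ℝ n).eval m 0
  have term (k : ℕ) : m.choose k • (fwdDiff 1)^[k] (ascPochhammer ℝ n).eval 0 =
      stirling2nd k n * (m.descFactorial k : ℝ) := by
    rw [← factorial_mul_stirling2nd hn, Nat.descFactorial_eq_factorial_mul_choose, nsmul_eq_mul]
    push_cast
    ring
  simp only [term, nsmul_eq_mul, mul_one, zero_add] at newton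
  rw [newton]
  have h_left : ∑ k ∈ range (m + 1), stirling2nd k n * (m.descFactorial k : ℝ) =
      ∑ k ∈ range (m + n + 1), stirling2nd k n * (m.descFactorial k : ℝ) := by
    refine Finset.sum_subset (Finset.range_mono (by lia)) fun k _ hk => ?_
    rw [Nat.descFactorial_of_lt (by simpa using hk), Nat.cast_zero, mul_zero]
  rw [h_left]
  refine Finset.sum_subset (fun k hk => ?_) fun k _ hk => ?_
  · simp only [Finset.mem_Icc, Finset.mem_range] at *
    lia
  · rcases Nat.eq_zero_or_pos k with rfl | hk0
    · simp [stirling2nd]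
    · have hnk : n < k := by
        simp only [Finset.mem_Icc] at hk
        lia
      rw [← term, Polynomial.fwdDiff_iter_eq_zero_of_degree_lt (by rwa [ascPochhammer_natDegree])]
      simp

theorem Eop_iterate_add (n : ℕ) (p q : Polynomial ℝ) :
    Eop^[n] (p + q) = Eop^[n] p + Eop^[n] q := by
  induction n generalizing p q with
  | zero => rfl
  | succ n ih => simp only [Function.iterate_succ_apply, ← ih, Eop, derivative_add, mul_add]

theorem Eop_iterate_C_mul_X_pow (n m : ℕ) (a : ℝ) :
    Eop^[n] (C a * X ^ m) = C (a * (ascPochhammer ℝ n).eval (m : ℝ)) * X ^ (m + n) := by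
  induction n with
  | zero => simp
  | succ n ih =>
    rw [Function.iterate_succ_apply', ih, Eop, derivative_C_mul_X_pow, ascPochhammer_succ_eval]
    rcases Nat.eq_zero_or_pos (m + n) with h | h
    · obtain ⟨rfl, rfl⟩ : m = 0 ∧ n = 0 := by lia
      simp
    · rw [mul_left_comm, ← pow_add, show 2 + (m + n - 1) = m + (n + 1) by lia]
      push_cast
      rw [mul_assoc]

/-- Operational identity `(x²∂ₓ)ⁿ = xⁿ ∑_{k=1}^n S₂²(k,n) xᵏ ∂ₓᵏ` for `n ≥ 1`. -/
theorem eop_iterate_eq (n : ℕ) (hn : 1 ≤ n) (p : Polynomial ℝ) :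
    Eop^[n] p = ∑ k ∈ Icc 1 n, C (stirling2nd k n) * X ^ (n + k) * derivative^[k] p := by
  induction p using Polynomial.induction_on' with
  | add p q hp hq =>
    simp only [Eop_iterate_add, hp, hq, iterate_map_add, mul_add, Finset.sum_add_distrib]
  | monomial m a =>
    rw [← C_mul_X_pow_eq_monomial, Eop_iterate_C_mul_X_pow,
      ← sum_stirling2nd_mul_descFactorial hn, Finset.mul_sum, map_sum, Finset.sum_mul]
    refine Finset.sum_congr rfl fun k _ => ?_
    rw [iterate_derivative_C_mul, iterate_derivative_X_pow_eq_C_mul]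
    rcases lt_or_ge m k with h | h
    · simp [Nat.descFactorial_of_lt h]
    · rw [show m + n = (n + k) + (m - k) by lia, pow_add]
      simp only [map_mul]
      ring
end

section
/- Fix an integer m ≥ 2 and ℓ ∈ ℕ. For every real x > 0 and every real t with (m−1)·|t|·x^{m−1} < 1, setting σ = (1 − (m−1)·t·x^{m−1})^{−1/(m−1)} (a positive real power), one has HasSum (fun n => t^n/n! * Tᵐ_{n+ℓ}.eval x) (Real.exp (x*(σ − 1)) * Tᵐ_ℓ.eval (x*σ)); i.e. ∑_{n=0}^∞ (t^n/n!)·Tᵐ_{n+ℓ}(x) = e^{x(σ−1)}·Tᵐ_ℓ(xσ). -/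
open Polynomial

/-- The `m`-th order Touchard polynomials, defined by `Tᵐ 0 = 1` and
`Tᵐ (n+1) = Xᵐ * (Tᵐ n + (Tᵐ n)')`. -/
noncomputable def TouchardHigher (m : ℕ) : ℕ → Polynomial ℝ
  | 0 => 1
  | n + 1 => X ^ m * (TouchardHigher m n + derivative (TouchardHigher m n))

/-- If `F (n + 1)` is the derivative of `F n` on an open set for every `n`, then the iterated
derivatives of `F n` there are the later terms of the sequence. -/
lemma iteratedDeriv_eq_of_hasDerivAt_succ {𝕜 : Type*} [NontriviallyNormedField 𝕜]
    {E : Type*} [NormedAddCommGroup E] [NormedSpace 𝕜 E] {F : ℕ → 𝕜 → E} {U : Set 𝕜}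
    (hU : IsOpen U) (hF : ∀ n, ∀ z ∈ U, HasDerivAt (F n) (F (n + 1) z) z) (k n : ℕ) {z : 𝕜}
    (hz : z ∈ U) : iteratedDeriv k (F n) z = F (k + n) z := by
  induction k generalizing z with
  | zero => simp
  | succ k ih =>
    have h : iteratedDeriv k (F n) =ᶠ[nhds z] F (k + n) := by
      filter_upwards [hU.mem_nhds hz] with w hw using ih hw
    rw [iteratedDeriv_succ, h.deriv_eq, (hF (k + n) z hz).deriv]
    congr 1
    omega

/-- If `y` solves `y' = y ^ m`, then differentiating `exp y * Tᵐ_n(y)` raises `n` by one. -/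
lemma hasDerivAt_exp_mul_touchardHigher {m : ℕ} {y : ℂ → ℂ} {z : ℂ} (c : ℂ)
    (hy : HasDerivAt y (y z ^ m) z) (n : ℕ) :
    HasDerivAt (fun w => Complex.exp (y w - c) * aeval (y w) (TouchardHigher m n))
      (Complex.exp (y z - c) * aeval (y z) (TouchardHigher m (n + 1))) z := by
  have hT : HasDerivAt (fun w => aeval (y w) (TouchardHigher m n))
      (aeval (y z) (derivative (TouchardHigher m n)) * y z ^ m) z :=
    ((TouchardHigher m n).hasDerivAt_aeval (y z)).comp z hy
  convert! ((hy.sub_const c).cexp.mul hT) using 1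
  simp only [TouchardHigher, map_mul, map_add, map_pow, aeval_X]
  ring

/-- The function `x (1 - (m-1) z x^{m-1})^{-1/(m-1)}` solves `y' = y ^ m`. -/
lemma hasDerivAt_mul_cpow_eq_pow {m : ℕ} (hm : 2 ≤ m) (x : ℂ) {z : ℂ}
    (hz : 1 - ((m : ℂ) - 1) * z * x ^ (m - 1) ∈ Complex.slitPlane) :
    HasDerivAt
      (fun w : ℂ => x * (1 - ((m : ℂ) - 1) * w * x ^ (m - 1)) ^ (-(1 / ((m : ℂ) - 1))))
      ((x * (1 - ((m : ℂ) - 1) * z * x ^ (m - 1)) ^ (-(1 / ((m : ℂ) - 1)))) ^ m) z := by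
  obtain ⟨k, rfl⟩ : ∃ k, m = k + 1 := ⟨m - 1, by omega⟩
  have hk : (k : ℂ) ≠ 0 := by
    exact_mod_cast (by omega : k ≠ 0)
  simp only [Nat.cast_add, Nat.cast_one, add_sub_cancel_right, Nat.add_sub_cancel] at hz ⊢
  have hu : HasDerivAt (fun w : ℂ => 1 - (k : ℂ) * w * x ^ k) (-((k : ℂ) * x ^ k)) z := by
    simpa using (((hasDerivAt_id z).const_mul (k : ℂ)).mul_const (x ^ k)).const_sub 1
  convert! ((hu.cpow_const (c := -(1 / (k : ℂ))) hz).const_mul x) using 1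
  have hu0 := Complex.slitPlane_ne_zero hz
  have hpow : ((1 - (k : ℂ) * z * x ^ k) ^ (-(1 / (k : ℂ)))) ^ (k + 1) =
      (1 - (k : ℂ) * z * x ^ k) ^ (-(1 / (k : ℂ)) - 1) := by
    rw [← Complex.cpow_mul_nat]
    congr 1
    push_cast
    field_simp
    ring
  rw [mul_pow, hpow]
  field_simp
  ring

/-- Generalized generating function of the `m`-th order Touchard polynomials:
with `σ = (1 - (m-1) t x^{m-1})^{-1/(m-1)}`, one has
`∑ₙ tⁿ/n! · Tᵐ_{n+ℓ}(x) = e^{x(σ-1)} Tᵐ_ℓ(xσ)`. -/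
theorem touchardHigher_shifted_generating_function (m : ℕ) (hm : 2 ≤ m) (ℓ : ℕ)
    (x t : ℝ) (hx : 0 < x) (ht : ((m : ℝ) - 1) * |t| * x ^ (m - 1) < 1)
    (σ : ℝ) (hσ : σ = (1 - ((m : ℝ) - 1) * t * x ^ (m - 1)) ^ (-(1 / ((m : ℝ) - 1)))) :
    HasSum (fun n : ℕ => t ^ n / (n.factorial : ℝ) * (TouchardHigher m (n + ℓ)).eval x)
      (Real.exp (x * (σ - 1)) * (TouchardHigher m ℓ).eval (x * σ)) := by
  have hm1 : 0 < (m : ℝ) - 1 := by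
    have : (2 : ℝ) ≤ m := by exact_mod_cast hm
    linarith
  have ha : 0 < ((m : ℝ) - 1) * x ^ (m - 1) := by positivity
  set r : ℝ := (((m : ℝ) - 1) * x ^ (m - 1))⁻¹ with hr
  have hball : ∀ z ∈ Metric.ball (0 : ℂ) r,
      1 - ((m : ℂ) - 1) * z * (x : ℂ) ^ (m - 1) ∈ Complex.slitPlane := by
    intro z hz
    rw [sub_eq_add_neg]
    apply Complex.mem_slitPlane_of_norm_lt_one
    have hcast : ((m : ℂ) - 1) * z * (x : ℂ) ^ (m - 1) =
        ((((m : ℝ) - 1) * x ^ (m - 1) : ℝ) : ℂ) * z := by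
      push_cast
      ring
    rw [mem_ball_zero_iff, hr, ← one_div, lt_div_iff₀ ha] at hz
    rw [norm_neg, hcast, norm_mul, Complex.norm_of_nonneg ha.le]
    linarith
  set y : ℂ → ℂ := fun w =>
    (x : ℂ) * (1 - ((m : ℂ) - 1) * w * (x : ℂ) ^ (m - 1)) ^ (-(1 / ((m : ℂ) - 1))) with hy
  set F : ℕ → ℂ → ℂ := fun n w =>
    Complex.exp (y w - x) * aeval (y w) (TouchardHigher m n) with hF
  have hderiv : ∀ n, ∀ z ∈ Metric.ball (0 : ℂ) r, HasDerivAt (F n) (F (n + 1) z) z :=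
    fun n z hz => hasDerivAt_exp_mul_touchardHigher x
      (hasDerivAt_mul_cpow_eq_pow hm x (hball z hz)) n
  have ht_mem : (t : ℂ) ∈ Metric.ball (0 : ℂ) r := by
    rw [mem_ball_zero_iff, Complex.norm_real, Real.norm_eq_abs, hr, ← one_div, lt_div_iff₀ ha]
    linarith
  have hr0 : 0 < r := inv_pos.mpr ha
  have hsum := Complex.hasSum_taylorSeries_on_ball (f := F ℓ)
    (fun z hz => (hderiv ℓ z hz).differentiableAt.differentiableWithinAt) ht_mem
  have hy0 : y 0 = x := by simp [hy]
  have hyt : y t = ((x * σ : ℝ) : ℂ) := by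
    have hbase : 0 ≤ 1 - ((m : ℝ) - 1) * t * x ^ (m - 1) := by
      have : ((m : ℝ) - 1) * t * x ^ (m - 1) ≤ ((m : ℝ) - 1) * |t| * x ^ (m - 1) := by
        gcongr
        exact le_abs_self t
      linarith
    rw [hσ, Complex.ofReal_mul, Complex.ofReal_cpow hbase]
    simp [hy]
  have haeval : ∀ (a : ℝ) (n : ℕ), aeval (a : ℂ) (TouchardHigher m n) =
      (((TouchardHigher m n).eval a : ℝ) : ℂ) := fun a n => by
    simpa using aeval_algebraMap_apply ℂ a (TouchardHigher m n)
  rw [← Complex.hasSum_ofReal]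
  convert! hsum using 1
  · funext n
    rw [iteratedDeriv_eq_of_hasDerivAt_succ Metric.isOpen_ball hderiv n ℓ
      (Metric.mem_ball_self hr0)]
    simp only [hF, hy0, haeval, sub_self, Complex.exp_zero, one_mul, sub_zero, smul_eq_mul]
    push_cast
    ring
  · simp only [hF, hyt, haeval]
    push_cast
    ring_nf
end

section
/- Fix an integer m ≥ 2. For every n ≥ 1, Tᵐ_n = (m−1)^n · ∑_{k=1}^n S₂ᵐ(k,n)·X^{(m−1)·n + k} as an identity in ℝ[X], where S₂ᵐ(k,n) = (1/k!)·∑_{j=1}^k (−1)^{k−j}·C(k,j)·∏_{i=0}^{n−1} (j/(m−1) + i). (Explicit expression of the m-th order Touchard polynomials through the generalized Stirling numbers S₂ᵐ(k,n) = (1/k!)·∑_j (−1)^{k−j}·C(k,j)·Γ(j/(m−1)+n)/Γ(j/(m−1)).) -/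
open Polynomial Finset

/-- The generalized Stirling numbers
`S₂ᵐ(k, n) = (1/k!) ∑_{j=1}^k (-1)^{k-j} C(k,j) Γ(j/(m-1)+n)/Γ(j/(m-1))`,
with the ratio of Gamma values written as the product `∏_{i=0}^{n-1} (j/(m-1) + i)`. -/
noncomputable def stirlingHigher (m k n : ℕ) : ℝ :=
  (1 / (k.factorial : ℝ)) *
    ∑ j ∈ Icc 1 k,
      (-1 : ℝ) ^ (k - j) * (k.choose j : ℝ) *
        ∏ i ∈ range n, ((j : ℝ) / ((m : ℝ) - 1) + (i : ℝ))

/-- The `k`-th Newton coefficient `(1/k!) ∑_{j=0}^k (-1)^{k-j} C(k,j) f(j)` of `f`. -/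
noncomputable def newtonCoeff (f : ℕ → ℝ) (k : ℕ) : ℝ :=
  (1 / (k.factorial : ℝ)) *
    ∑ j ∈ range (k + 1), (-1 : ℝ) ^ (k - j) * (k.choose j : ℝ) * f j

lemma newtonCoeff_zero (f : ℕ → ℝ) : newtonCoeff f 0 = f 0 := by
  simp [newtonCoeff]

lemma newtonCoeff_mul_add (f : ℕ → ℝ) (c : ℝ) (k : ℕ) :
    newtonCoeff (fun j => f j * (j + c)) (k + 1) =
      newtonCoeff f k + (k + 1 + c) * newtonCoeff f (k + 1) := by
  have key : ∑ j ∈ range (k + 2),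
      (-1 : ℝ) ^ (k + 1 - j) * ((k + 1).choose j : ℝ) * (f j * (j + c)) =
      (k + 1) * ∑ j ∈ range (k + 1), (-1 : ℝ) ^ (k - j) * (k.choose j : ℝ) * f j +
      (k + 1 + c) * ∑ j ∈ range (k + 2),
        (-1 : ℝ) ^ (k + 1 - j) * ((k + 1).choose j : ℝ) * f j := by
    have term : ∀ j ∈ range (k + 1),
        (-1 : ℝ) ^ (k + 1 - j) * ((k + 1).choose j : ℝ) * (f j * (j + c)) =
        (k + 1) * ((-1 : ℝ) ^ (k - j) * (k.choose j : ℝ) * f j) +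
        (k + 1 + c) * ((-1 : ℝ) ^ (k + 1 - j) * ((k + 1).choose j : ℝ) * f j) := by
      intro j hj
      obtain ⟨l, rfl⟩ := Nat.exists_eq_add_of_le (Nat.lt_succ_iff.mp (mem_range.mp hj))
      have hc : (((j + l).choose j : ℕ) : ℝ) * (j + l + 1) =
          ((j + l + 1).choose j : ℝ) * (l + 1) := by
        have := Nat.choose_mul_succ_eq (j + l) j
        rw [show j + l + 1 - j = l + 1 by lia] at this
        exact_mod_cast this
      rw [show j + l + 1 - j = l + 1 by lia, show j + l - j = l by lia, pow_succ]
      push_cast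
      linear_combination (-(-1 : ℝ) ^ l * f j) * hc
    rw [sum_range_succ, sum_range_succ _ (k + 1), sum_congr rfl term, sum_add_distrib,
      ← mul_sum, ← mul_sum]
    push_cast
    simp
    ring
  have hk : (k.factorial : ℝ) ≠ 0 := by positivity
  simp only [newtonCoeff]
  rw [key, Nat.factorial_succ]
  push_cast
  field_simp

lemma newtonCoeff_one_succ (k : ℕ) : newtonCoeff (fun _ => 1) (k + 1) = 0 := by
  have h := add_pow (1 : ℝ) (-1) (k + 1)
  simp only [add_neg_cancel, one_pow, one_mul, ne_eq, Nat.add_eq_zero_iff, one_ne_zero,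
    and_false, not_false_eq_true, zero_pow] at h
  simp [newtonCoeff, ← h]

lemma newtonCoeff_prod_eq_zero (c : ℝ) {n k : ℕ} (h : n < k) :
    newtonCoeff (fun j => ∏ i ∈ range n, ((j : ℝ) + c * i)) k = 0 := by
  induction n generalizing k with
  | zero =>
    obtain ⟨k, rfl⟩ := Nat.exists_eq_succ_of_ne_zero h.ne'
    simpa using newtonCoeff_one_succ k
  | succ n ih =>
    obtain ⟨k, rfl⟩ := Nat.exists_eq_succ_of_ne_zero (Nat.ne_zero_of_lt h)
    simp only [prod_range_succ, Nat.succ_eq_add_one, newtonCoeff_mul_add]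
    rw [ih (by lia), ih (by lia)]
    ring

lemma touchardHigher_succ_eq_sum_newtonCoeff (d n : ℕ) :
    TouchardHigher (d + 1) n = ∑ k ∈ range (n + 1),
      C (newtonCoeff (fun j => ∏ i ∈ range n, ((j : ℝ) + d * i)) k) * X ^ (d * n + k) := by
  induction n with
  | zero => simp [TouchardHigher, newtonCoeff_zero]
  | succ n ih =>
    set a := newtonCoeff (fun j => ∏ i ∈ range n, ((j : ℝ) + d * i)) with ha
    have hder : ∀ k : ℕ, (X : ℝ[X]) ^ (d + 1) * derivative (C (a k) * X ^ (d * n + k)) =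
        C ((k + d * n) * a k) * X ^ (d * (n + 1) + k) := by
      intro k
      rw [derivative_C_mul_X_pow]
      rcases Nat.eq_zero_or_pos (d * n + k) with h | h
      · have h' : (k : ℝ) + d * n = 0 := by rw [add_comm]; exact_mod_cast h
        rw [h, h']
        simp
      · obtain ⟨e, he⟩ := Nat.exists_eq_succ_of_ne_zero h.ne'
        have h' : (k : ℝ) + d * n = (d * n + k : ℕ) := by push_cast; ring
        rw [h', show d * (n + 1) + k = d + 1 + e by rw [mul_add]; lia, he]
        simp only [Nat.succ_eq_add_one, Nat.add_sub_cancel, pow_add, C_mul]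
        ring
    have hsum : ∑ k ∈ range (n + 1), C ((k + d * n) * a k) * (X : ℝ[X]) ^ (d * (n + 1) + k) =
        ∑ k ∈ range (n + 2), C ((k + d * n) * a k) * (X : ℝ[X]) ^ (d * (n + 1) + k) := by
      rw [sum_range_succ _ (n + 1), ha, newtonCoeff_prod_eq_zero _ (Nat.lt_succ_self n)]
      simp
    rw [TouchardHigher, ih, derivative_sum, mul_add, mul_sum, mul_sum,
      sum_congr rfl fun k _ => hder k, hsum, sum_range_succ' _ (n + 1),
      sum_range_succ' _ (n + 1), ← add_assoc, ← sum_add_distrib]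
    simp only [prod_range_succ, newtonCoeff_mul_add, newtonCoeff_zero, ← ha]
    congr 1
    · refine sum_congr rfl fun k _ => ?_
      simp only [C_add, C_mul, Nat.cast_add, Nat.cast_one]
      ring
    · rw [ha, newtonCoeff_zero, mul_comm (∏ i ∈ range n, _)]

lemma newtonCoeff_prod_eq_stirlingHigher {d n : ℕ} (hd : d ≠ 0) (hn : n ≠ 0) (k : ℕ) :
    newtonCoeff (fun j => ∏ i ∈ range n, ((j : ℝ) + d * i)) k =
      (d : ℝ) ^ n * stirlingHigher (d + 1) k n := by
  have hd' : (d : ℝ) ≠ 0 := by exact_mod_cast hd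
  have hprod : ∀ j : ℕ, ∏ i ∈ range n, ((j : ℝ) + d * i) =
      (d : ℝ) ^ n * ∏ i ∈ range n, ((j : ℝ) / d + i) := by
    intro j
    rw [← card_range n, ← prod_const, card_range, ← prod_mul_distrib]
    refine prod_congr rfl fun i _ => ?_
    field_simp
  have hzero : ∏ i ∈ range n, (((0 : ℕ) : ℝ) / d + i) = 0 :=
    prod_eq_zero (mem_range.mpr (Nat.pos_of_ne_zero hn)) (by simp)
  simp only [newtonCoeff, stirlingHigher, hprod, Nat.cast_add, Nat.cast_one, add_sub_cancel_right]
  rw [range_eq_Ico, sum_eq_sum_Ico_succ_bot (Nat.succ_pos k), hzero,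
    mul_left_comm ((d : ℝ) ^ n) (1 / (k.factorial : ℝ)), mul_sum]
  simp only [mul_zero, zero_add]
  congr 1
  exact sum_congr rfl fun j _ => mul_left_comm _ _ _

/-- Explicit expression of the `m`-th order Touchard polynomials through the
generalized Stirling numbers:
`Tᵐₙ = (m-1)ⁿ ∑_{k=1}^n S₂ᵐ(k,n) X^{(m-1)n+k}` for `m ≥ 2`, `n ≥ 1`. -/
theorem touchardHigher_explicit (m : ℕ) (hm : 2 ≤ m) (n : ℕ) (hn : 1 ≤ n) :
    TouchardHigher m n =
      C (((m : ℝ) - 1) ^ n) *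
        ∑ k ∈ Icc 1 n, C (stirlingHigher m k n) * X ^ ((m - 1) * n + k) := by
  obtain ⟨d, rfl⟩ : ∃ d, m = d + 1 := ⟨m - 1, by lia⟩
  have h (k : ℕ) := newtonCoeff_prod_eq_stirlingHigher (d := d) (n := n) (by lia) (by lia) k
  have h0 : stirlingHigher (d + 1) 0 n = 0 := by simp [stirlingHigher]
  rw [touchardHigher_succ_eq_sum_newtonCoeff, range_eq_Ico,
    sum_eq_sum_Ico_succ_bot (Nat.succ_pos n), mul_sum]
  simp only [h, h0, mul_zero, C_0, zero_mul, zero_add, Nat.cast_add, Nat.cast_one,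
    add_sub_cancel_right, Nat.add_sub_cancel, C_mul, mul_assoc]
  rfl
end

section
/- Let g : ℕ → ℝ → ℝ be defined by g 0 x = Real.exp (1/x) and g (n+1) x = x^3 * deriv (g n) x. Then for every real x ≠ 0 and every real t with 2·|t|·x² < 1, HasSum (fun n => t^n/n! * g n x) (Real.exp (Real.sqrt (1 − 2*t*x^2) / x)); i.e. ∑_{n=0}^∞ (t^n/n!)·e^{-1/x}·(x³ d/dx)^n e^{1/x} = e^{(√(1−2tx²) − 1)/x}. (Generating function of the Bessel-type polynomials δ_n(x) = e^{−1/x}(x³∂_x)^n e^{1/x}.) -/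
/-- The holomorphic function `z ↦ exp (σ √z)`, with the principal branch of the square root. -/
noncomputable def expSqrt (σ : ℝ) (z : ℂ) : ℂ :=
  Complex.exp (σ * z ^ (1 / 2 : ℂ))

theorem differentiableOn_expSqrt (σ : ℝ) : DifferentiableOn ℂ (expSqrt σ) Complex.slitPlane := by
  intro z hz
  have h : DifferentiableAt ℂ (fun z : ℂ => z ^ (1 / 2 : ℂ)) z :=
    differentiableAt_id.cpow_const hz
  exact ((h.const_mul _).cexp).differentiableWithinAt

theorem hasDerivAt_iteratedDeriv_expSqrt (σ : ℝ) (n : ℕ) {z : ℂ} (hz : z ∈ Complex.slitPlane) :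
    HasDerivAt (iteratedDeriv n (expSqrt σ)) (iteratedDeriv (n + 1) (expSqrt σ) z) z := by
  rw [iteratedDeriv_succ, hasDerivAt_deriv_iff, iteratedDeriv_eq_iterate]
  exact (((differentiableOn_expSqrt σ).analyticOnNhd
    Complex.isOpen_slitPlane).iterated_deriv n z hz).differentiableAt

/-- For `x` of the same sign as `σ = ±1`, the real number `√y` with `y > 0` satisfies
`σ √y = √(x² y) / x`. -/
theorem expSqrt_ofReal_re {σ x y : ℝ} (hσ : |x| = σ * x) (hx : x ≠ 0) (hy : 0 ≤ y) :
    (expSqrt σ (y : ℂ)).re = Real.exp (Real.sqrt (x ^ 2 * y) / x) := by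
  have h1 : ((y : ℂ) ^ (1 / 2 : ℂ)) = ((Real.sqrt y : ℝ) : ℂ) := by
    rw [Real.sqrt_eq_rpow, Complex.ofReal_cpow hy]
    norm_num
  have h2 : Real.sqrt (x ^ 2 * y) / x = σ * Real.sqrt y := by
    rw [Real.sqrt_mul (sq_nonneg x), Real.sqrt_sq_eq_abs, hσ]
    field_simp
  rw [expSqrt, h1, h2, ← Complex.ofReal_mul, Complex.exp_ofReal_re]

/-- In the variable `u = 1 / x²` the operator `x³ d/dx` becomes `-2 d/du`. -/
theorem iterate_eq_re_iteratedDeriv_expSqrt {g : ℕ → ℝ → ℝ}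
    (h0 : ∀ x, g 0 x = Real.exp (1 / x))
    (hrec : ∀ n x, g (n + 1) x = x ^ 3 * deriv (g n) x)
    {σ : ℝ} (hσ : σ ^ 2 = 1) (n : ℕ) :
    ∀ x : ℝ, 0 < σ * x →
      g n x = ((-2) ^ n * iteratedDeriv n (expSqrt σ) (((x : ℂ) ^ 2)⁻¹)).re := by
  induction n with
  | zero =>
    intro x hx
    have hx0 : x ≠ 0 := right_ne_zero_of_mul hx.ne'
    have habs : |x| = σ * x := by
      have hone : |σ| = 1 :=
        (sq_eq_sq₀ (abs_nonneg σ) zero_le_one).mp (by rw [sq_abs, hσ, one_pow])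
      rw [← abs_of_pos hx, abs_mul, hone, one_mul]
    have h := expSqrt_ofReal_re habs hx0 (y := (x ^ 2)⁻¹) (by positivity)
    rw [mul_inv_cancel₀ (pow_ne_zero 2 hx0), Real.sqrt_one] at h
    rw [h0, ← h]
    simp
  | succ n ih =>
    intro x hx
    have hx0 : x ≠ 0 := right_ne_zero_of_mul hx.ne'
    have hxc : (x : ℂ) ≠ 0 := Complex.ofReal_ne_zero.mpr hx0
    have hmem : ((x : ℂ) ^ 2)⁻¹ ∈ Complex.slitPlane := by
      have : 0 < (x ^ 2)⁻¹ := by positivity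
      simpa using Complex.ofReal_mem_slitPlane.mpr this
    have hinner : HasDerivAt (fun z : ℂ => (z ^ 2)⁻¹) (-(2 * x) / ((x : ℂ) ^ 2) ^ 2) (x : ℂ) := by
      simpa using (hasDerivAt_pow 2 (x : ℂ)).fun_inv (pow_ne_zero 2 hxc)
    have hd := (((hasDerivAt_iteratedDeriv_expSqrt σ n hmem).comp (x : ℂ) hinner).const_mul
      ((-2 : ℂ) ^ n)).real_of_complex
    have hev : g n =ᶠ[nhds x] fun y : ℝ =>
        ((-2) ^ n * iteratedDeriv n (expSqrt σ) (((y : ℂ) ^ 2)⁻¹)).re := by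
      have : ∀ᶠ y in nhds x, 0 < σ * y :=
        (continuous_const.mul continuous_id).continuousAt.eventually (lt_mem_nhds hx)
      filter_upwards [this] with y hy using ih y hy
    rw [hrec, (hd.congr_of_eventuallyEq hev).deriv, ← Complex.re_ofReal_mul]
    congr 1
    push_cast
    field_simp
    ring

/-- Generating function of the Bessel-type polynomials
`δₙ(x) = e^{-1/x} (x³∂ₓ)ⁿ e^{1/x}`:
if `g 0 x = e^{1/x}` and `g (n+1) x = x³ · (g n)'(x)`, then
`∑ₙ tⁿ/n! · g n x = e^{√(1 - 2tx²)/x}` whenever `x ≠ 0` and `2|t|x² < 1`. -/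
theorem bessel_type_generating_function (g : ℕ → ℝ → ℝ)
    (h0 : ∀ x, g 0 x = Real.exp (1 / x))
    (hrec : ∀ n x, g (n + 1) x = x ^ 3 * deriv (g n) x) :
    ∀ x : ℝ, x ≠ 0 → ∀ t : ℝ, 2 * |t| * x ^ 2 < 1 →
      HasSum (fun n : ℕ => t ^ n / (n.factorial : ℝ) * g n x)
        (Real.exp (Real.sqrt (1 - 2 * t * x ^ 2) / x)) := by
  intro x hx t ht
  obtain ⟨σ, hσ, habs⟩ : ∃ σ : ℝ, σ ^ 2 = 1 ∧ |x| = σ * x := by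
    rcases abs_choice x with h | h
    · exact ⟨1, by norm_num, by rw [h, one_mul]⟩
    · exact ⟨-1, by norm_num, by rw [h, neg_one_mul]⟩
  have hx2 : 0 < x ^ 2 := by positivity
  have hpos : 0 < σ * x := habs ▸ abs_pos.mpr hx
  have htu : 2 * |t| < (x ^ 2)⁻¹ := by
    rwa [← one_div, lt_div_iff₀ hx2]
  set u : ℝ := (x ^ 2)⁻¹ with hu
  have hball : DifferentiableOn ℂ (expSqrt σ) (Metric.ball (u : ℂ) u) := by
    refine (differentiableOn_expSqrt σ).mono fun z hz => Or.inl ?_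
    rw [Metric.mem_ball, dist_eq_norm] at hz
    have h := (Complex.abs_re_le_norm (z - u)).trans_lt hz
    rw [Complex.sub_re, Complex.ofReal_re] at h
    linarith [(abs_lt.mp h).1]
  have hz : ((u - 2 * t : ℝ) : ℂ) ∈ Metric.ball (u : ℂ) u := by
    rw [Metric.mem_ball, dist_eq_norm, ← Complex.ofReal_sub, Complex.norm_real, Real.norm_eq_abs,
      sub_sub_cancel_left, abs_neg, abs_mul, abs_two]
    exact htu
  have hsum := Complex.hasSum_re (Complex.hasSum_taylorSeries_on_ball hball hz)
  have hy : 0 ≤ u - 2 * t := by linarith [le_abs_self t]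
  have hxu : x ^ 2 * (u - 2 * t) = 1 - 2 * t * x ^ 2 := by
    rw [mul_sub, hu, mul_inv_cancel₀ hx2.ne']
    ring
  rw [expSqrt_ofReal_re habs hx hy, hxu] at hsum
  convert hsum using 2 with n
  rw [iterate_eq_re_iteratedDeriv_expSqrt h0 hrec hσ n x hpos, ← Complex.re_ofReal_mul]
  congr 1
  have hc : ((x : ℂ) ^ 2)⁻¹ = (u : ℂ) := by
    rw [hu]
    push_cast
    rfl
  have hs : ((u - 2 * t : ℝ) : ℂ) - u = (-2) * t := by
    push_cast
    ring
  rw [hc, hs, smul_eq_mul, smul_eq_mul, mul_pow]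
  push_cast
  ring
end
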